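/- arXiv:1301.7465 — 2 statements merged into one kernel-verified Lean document; each statement's English description precedes it below -/
import Mathlib

section
/- There exists a computable {1}-martingale (the martingale with initial capital 1 that always bets exactly 1 on +1) M such that for any countable collection {S_e} of nonnegative integer-valued supermartingales, there exists a binary sequence x on which M(x↾n) → ∞ and M never goes bankrupt, while no S_e achieves ∞-consumption on x (i.e., for each e, the accumulated consumption of S_e along x is bounded). That is, ({1}, ∞-gains) anti-implies (ℤ, ∞-consumption). -/
open Filter

noncomputable section

/-- The length-`n` prefix of an infinite binary sequence (`true` = +1, `false` = -1). -/
def pre (x : ℕ → Bool) (n : ℕ) : List Bool := (List.range n).map x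

/-- The increment (wager) of `M` at `σ`: `M'(σ) = (M(σ,+1) - M(σ,-1))/2`. -/
def inc (M : List Bool → ℝ) (σ : List Bool) : ℝ :=
  (M (σ ++ [true]) - M (σ ++ [false])) / 2

/-- The marginal consumption of `M` at `σ`. -/
def marginal (M : List Bool → ℝ) (σ : List Bool) : ℝ :=
  M σ - (M (σ ++ [false]) + M (σ ++ [true])) / 2

def IsSupermartingale (M : List Bool → ℝ) : Prop :=
  ∀ σ, (M (σ ++ [false]) + M (σ ++ [true])) / 2 ≤ M σ

def IsMartingale (M : List Bool → ℝ) : Prop :=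
  ∀ σ, M σ = (M (σ ++ [false]) + M (σ ++ [true])) / 2

/-- The proper cover of `M`: the martingale with the same initial capital and increments. -/
def cover (M : List Bool → ℝ) (σ : List Bool) : ℝ :=
  M [] + ∑ k ∈ Finset.range σ.length,
    (if σ.getD k false then inc M (σ.take k) else - inc M (σ.take k))

/-- `M` goes bankrupt at `σ`. -/
def Bankrupts (M : List Bool → ℝ) (σ : List Bool) : Prop :=
  M σ - |inc M σ| < marginal M σ

/-- `M` goes bankrupt on `x`. -/
def BankruptOn (M : List Bool → ℝ) (x : ℕ → Bool) : Prop :=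
  ∃ n, Bankrupts M (pre x n)

/-- `M` achieves ∞-gains on `x`. -/
def AchievesGains (M : List Bool → ℝ) (x : ℕ → Bool) : Prop :=
  ¬ BankruptOn M x ∧ Tendsto (fun n => M (pre x n)) atTop atTop

/-- `M` achieves ∞-consumption on `x`. -/
def AchievesConsumption (M : List Bool → ℝ) (x : ℕ → Bool) : Prop :=
  ¬ BankruptOn M x ∧ Tendsto (fun n => cover M (pre x n) - M (pre x n)) atTop atTop

/-- `M` achieves oscillation on `x`. -/
def AchievesOscillation (M : List Bool → ℝ) (x : ℕ → Bool) : Prop :=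
  ¬ BankruptOn M x ∧
    liminf (fun n => ((cover M (pre x n) : ℝ) : EReal)) atTop ≠
      limsup (fun n => ((cover M (pre x n) : ℝ) : EReal)) atTop

/-- An `A`-(super)martingale: all wagers lie in `A`. -/
def WagersIn (M : List Bool → ℝ) (A : Set ℝ) : Prop := ∀ σ, inc M σ ∈ A

/-- History independence: the wager depends only on the length of the history. -/
def HistoryIndependent (M : List Bool → ℝ) : Prop :=
  ∀ σ τ : List Bool, σ.length = τ.length → inc M σ = inc M τ

/-- The wager set `V = {a : |a| ≥ 1} ∪ {0}`. -/
def Vset : Set ℝ := {a : ℝ | 1 ≤ |a|} ∪ {0}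


lemma finite_bad (K : ℕ → ℝ) (bad : ℕ → Prop) (c : ℕ) : ∀ N : ℕ, K N < c →
    (∀ n, N ≤ n → 0 ≤ K n) → (∀ n, N ≤ n → K (n+1) ≤ K n) →
    (∀ n, N ≤ n → bad n → K (n+1) ≤ K n - 1) → ∃ N', N ≤ N' ∧ ∀ n, N' ≤ n → ¬ bad n := by
  induction c with
  | zero =>
    intro N h1 h2 _ _
    have := h2 N le_rfl
    simp at h1
    linarith
  | succ c ih =>
    intro N h1 h2 h3 h4
    by_cases h : ∃ n, N ≤ n ∧ bad n
    · obtain ⟨n, hn, hb⟩ := h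
      have hm : ∀ k, N ≤ k → K k ≤ K N := by
        intro k hk
        induction k, hk using Nat.le_induction with
        | base => exact le_rfl
        | succ k hk ihk => exact (h3 k hk).trans ihk
      have e1 := h4 n hn hb
      have e2 := hm n hn
      obtain ⟨N', hN', h⟩ := ih (n+1) (by push_cast at h1; linarith)
        (fun k hk => h2 k (by omega)) (fun k hk => h3 k (by omega))
        (fun k hk => h4 k (by omega))
      exact ⟨N', by omega, h⟩
    · push Not at h
      exact ⟨N, le_rfl, h⟩

/-- The game along the path, as sequences. -/
structure Game (s W : ℕ → ℕ → ℝ) (d q : ℕ → ℕ → ℤ) (b : ℕ → Bool) (ξ : ℕ → ℝ)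
    (z : ℕ → ℤ) : Prop where
  hξt : ∀ n, b n = true → ξ n = 1
  hξf : ∀ n, b n = false → ξ n = -1
  W00 : W 0 0 = 1
  W0 : ∀ n, W 0 (n+1) = W 0 n + ξ n
  hz : ∀ n, W 0 n = z n
  s0 : ∀ e n, 0 ≤ s e n
  hs : ∀ e n, s e (n+1) ≤ s e n + d e n * ξ n
  hd : ∀ e n, (d e n : ℝ) ≤ s e n
  hq : ∀ e n, q e n = ⌊s e n / W e n⌋
  hW : ∀ e n, W (e+1) n = (q e n + 1) * W e n - s e n
  rt : ∀ e n, (∀ j < e, d j n = q j n) → d e n < q e n → b n = true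
  rf : ∀ e n, (∀ j < e, d j n = q j n) → q e n < d e n → b n = false
  ra : ∀ n, (∀ j, d j n = q j n) → b n = true

namespace Game
variable {s W : ℕ → ℕ → ℝ} {d q : ℕ → ℕ → ℤ} {b : ℕ → Bool} {ξ : ℕ → ℝ} {z : ℕ → ℤ}

lemma fl (G : Game s W d q b ξ z) {e n : ℕ} (h : 0 < W e n) :
    (q e n : ℝ) * W e n ≤ s e n ∧ s e n < (q e n + 1) * W e n ∧ 0 ≤ q e n := by
  rw [G.hq]
  refine ⟨?_, ?_, ?_⟩
  · exact (le_div_iff₀ h).1 (Int.floor_le _)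
  · exact (div_lt_iff₀ h).1 (Int.lt_floor_add_one _)
  · exact Int.floor_nonneg.2 (div_nonneg (G.s0 e n) h.le)

lemma pos0 (G : Game s W d q b ξ z) {n : ℕ} (h : 0 < W 0 n) (e : ℕ) : 0 < W e n := by
  induction e with
  | zero => exact h
  | succ e ih =>
    rw [G.hW]
    have := (G.fl ih).2.1
    linarith

lemma anti0 (G : Game s W d q b ξ z) {n : ℕ} (h : 0 < W 0 n) : Antitone (fun e => W e n) := by
  refine antitone_nat_of_succ_le fun e => ?_
  rw [G.hW]
  have := (G.fl (G.pos0 h e)).1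
  linarith

lemma neg0 (G : Game s W d q b ξ z) {n : ℕ} (h : 0 < W 0 n) (hb : b n = false) :
    ∃ f, q f n < d f n ∧ (∀ j < f, d j n = q j n) ∧ 1 < W f n := by
  classical
  have hex : ∃ f, d f n ≠ q f n := by
    by_contra hc
    push Not at hc
    have := G.ra n hc
    simp [hb] at this
  have hlt : ∀ j < Nat.find hex, d j n = q j n := fun j hj => by
    have := Nat.find_min hex hj
    simpa using this
  have hne := Nat.find_spec hex
  set f := Nat.find hex
  have hgt : q f n < d f n := by
    rcases lt_or_gt_of_ne hne with h1 | h1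
    · have := G.rt f n hlt h1
      simp [hb] at this
    · exact h1
  refine ⟨f, hgt, hlt, ?_⟩
  obtain ⟨h1, h2, h3⟩ := G.fl (G.pos0 h f)
  have h4 := G.hd f n
  have h5 : (q f n : ℝ) + 1 ≤ d f n := by exact_mod_cast hgt
  have h6 : (0:ℝ) ≤ q f n := by exact_mod_cast h3
  by_contra hc
  push Not at hc
  nlinarith

lemma one_le (G : Game s W d q b ξ z) (n : ℕ) : 1 ≤ W 0 n := by
  induction n with
  | zero => rw [G.W00]
  | succ n ih =>
    rw [G.W0]
    cases hb : b n with
    | true => rw [G.hξt n hb]; linarith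
    | false =>
      rw [G.hξf n hb]
      obtain ⟨f, _, _, hf⟩ := G.neg0 (by linarith) hb
      have : 1 < W 0 n := lt_of_lt_of_le hf (G.anti0 (by linarith) (Nat.zero_le f))
      rw [G.hz] at this ⊢
      have h2 : 1 < z n := by exact_mod_cast this
      have h3 : (2:ℝ) ≤ z n := by exact_mod_cast h2
      linarith

lemma pos (G : Game s W d q b ξ z) (e n : ℕ) : 0 < W e n :=
  G.pos0 (by linarith [G.one_le n]) e

lemma anti (G : Game s W d q b ξ z) (n : ℕ) : Antitone (fun e => W e n) :=
  G.anti0 (G.pos 0 n)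

lemma step (G : Game s W d q b ξ z) {e n : ℕ} (h1 : ∀ j < e, d j n = q j n)
    (h2 : W e n + ξ n ≤ W e (n+1)) :
    q e (n+1) ≤ q e n ∧
    s e (n+1) - q e n * W e (n+1) ≤ s e n - q e n * W e n ∧
    (d e n ≠ q e n → s e (n+1) - q e n * W e (n+1) ≤ s e n - q e n * W e n - 1) := by
  obtain ⟨f1, f2, f3⟩ := G.fl (G.pos e n)
  have f3' : (0:ℝ) ≤ q e n := by exact_mod_cast f3
  have hs := G.hs e n
  have hm : (q e n : ℝ) * (W e n + ξ n) ≤ q e n * W e (n+1) := by gcongr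
  have hm1 : ((q e n : ℝ) + 1) * (W e n + ξ n) ≤ (q e n + 1) * W e (n+1) := by gcongr
  have key : s e (n+1) < (q e n + 1) * W e (n+1) → q e (n+1) ≤ q e n := by
    intro h
    rw [G.hq e (n+1)]
    apply Int.lt_add_one_iff.1
    rw [Int.floor_lt, div_lt_iff₀ (G.pos e (n+1))]
    push_cast
    exact h
  rcases lt_trichotomy (d e n) (q e n) with h | h | h
  · have hx := G.hξt n (G.rt e n h1 h)
    have h' : (d e n : ℝ) + 1 ≤ q e n := by exact_mod_cast h
    rw [hx] at hs hm hm1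
    refine ⟨key (by linarith), by linarith, fun _ => by linarith⟩
  · rw [h] at hs
    refine ⟨key ?_, by linarith, fun h' => absurd h h'⟩
    cases hb : b n with
    | true => rw [G.hξt n hb] at hs hm hm1; linarith
    | false =>
      obtain ⟨f, g1, g2, g3⟩ := G.neg0 (G.pos 0 n) hb
      have hef : e + 1 ≤ f := by
        by_contra hc
        rcases Nat.lt_or_ge f e with h4 | h4
        · have := h1 f h4; omega
        · have : f = e := by omega
          subst this; omega
      have h5 : W f n ≤ W (e+1) n := G.anti n hef
      rw [G.hW] at h5
      rw [G.hξf n hb] at hs hm hm1; linarith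
  · have hx := G.hξf n (G.rf e n h1 h)
    have h' : (q e n : ℝ) + 1 ≤ d e n := by exact_mod_cast h
    rw [hx] at hs hm hm1
    refine ⟨key (by linarith), by linarith, fun _ => by linarith⟩

def Stable (s W : ℕ → ℕ → ℝ) (d q : ℕ → ℕ → ℤ) (ξ : ℕ → ℝ) (e N : ℕ) : Prop :=
  ∀ n, N ≤ n → (∀ j < e, d j n = q j n) ∧ W e n + ξ n ≤ W e (n+1)

lemma settle (G : Game s W d q b ξ z) {e N : ℕ} (h : Stable s W d q ξ e N) :
    ∃ N', N ≤ N' ∧ ∀ n, N' ≤ n → d e n = q e n ∧ q e (n+1) = q e n := by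
  obtain ⟨c, hc⟩ := exists_nat_gt (q e N : ℝ)
  obtain ⟨N1, hN1, h1⟩ := finite_bad (fun n => (q e n : ℝ)) (fun n => q e (n+1) ≠ q e n) c N hc
    (fun n _ => by exact_mod_cast (G.fl (G.pos e n)).2.2)
    (fun n hn => by exact_mod_cast (G.step (h n hn).1 (h n hn).2).1)
    (fun n hn hb => by
      have := (G.step (h n hn).1 (h n hn).2).1
      have h2 : q e (n+1) ≤ q e n - 1 := by omega
      exact_mod_cast h2)
  have h1' : ∀ n, N1 ≤ n → q e (n+1) = q e n := fun n hn => by simpa using h1 n hn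
  obtain ⟨c, hc⟩ := exists_nat_gt (s e N1 - q e N1 * W e N1)
  obtain ⟨N2, hN2, h2⟩ := finite_bad (fun n => s e n - q e n * W e n)
    (fun n => d e n ≠ q e n) c N1 hc
    (fun n _ => by have := (G.fl (G.pos e n)).1; linarith)
    (fun n hn => by
      have := (G.step (h n (by omega)).1 (h n (by omega)).2).2.1
      simp only [h1' n hn]; exact this)
    (fun n hn hb => by
      have := (G.step (h n (by omega)).1 (h n (by omega)).2).2.2 hb
      simp only [h1' n hn]; exact this)
  exact ⟨N2, by omega, fun n hn => ⟨by simpa using h2 n hn, h1' n (by omega)⟩⟩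

lemma stable (G : Game s W d q b ξ z) (e : ℕ) : ∃ N, Stable s W d q ξ e N := by
  induction e with
  | zero => exact ⟨0, fun n _ => ⟨fun j hj => by omega, by rw [G.W0]⟩⟩
  | succ e ih =>
    obtain ⟨N, hN⟩ := ih
    obtain ⟨N', hN', h⟩ := G.settle hN
    refine ⟨N', fun n hn => ⟨fun j hj => ?_, ?_⟩⟩
    · rcases Nat.lt_or_ge j e with h4 | h4
      · exact (hN n (by omega)).1 j h4
      · have : j = e := by omega
        subst this; exact (h n hn).1
    · obtain ⟨h1, h2⟩ := h n hn
      rw [G.hW, G.hW, h2]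
      have f3 : (0:ℝ) ≤ q e n := by exact_mod_cast (G.fl (G.pos e n)).2.2
      have hs := G.hs e n
      have hw := (hN n (by omega)).2
      have hm1 : ((q e n : ℝ) + 1) * (W e n + ξ n) ≤ (q e n + 1) * W e (n+1) := by gcongr
      rw [h1] at hs
      linarith

lemma bounded (G : Game s W d q b ξ z) (e : ℕ) (C : ℕ → ℝ)
    (hC : ∀ n, C (n+1) = C n + d e n * ξ n) :
    ∃ B N, ∀ n, N ≤ n → C n - s e n ≤ B := by
  obtain ⟨N, hN⟩ := G.stable e
  obtain ⟨N', hN', h⟩ := G.settle hN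
  have main : ∀ n, N' ≤ n → C n - s e n + (s e n - q e n * W e n) ≤
      C N' - s e N' + (s e N' - q e N' * W e N') := by
    intro n hn
    induction n, hn using Nat.le_induction with
    | base => exact le_rfl
    | succ n hn ih =>
      refine le_trans ?_ ih
      obtain ⟨h1, h2⟩ := h n hn
      rw [h2, hC, h1]
      have f3 : (0:ℝ) ≤ q e n := by exact_mod_cast (G.fl (G.pos e n)).2.2
      have hw := (hN n (by omega)).2
      have hm : (q e n : ℝ) * (W e n + ξ n) ≤ q e n * W e (n+1) := by gcongr
      linarith
  refine ⟨_, N', fun n hn => le_trans ?_ (main n hn)⟩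
  have := (G.fl (G.pos e n)).1
  linarith

lemma big (G : Game s W d q b ξ z) (e : ℕ) (hd : ∀ n, d e n = 0) :
    ∃ N, ∀ n, N ≤ n → s e n ≤ W 0 n := by
  obtain ⟨N, hN⟩ := G.stable e
  obtain ⟨N', hN', h⟩ := G.settle hN
  refine ⟨N', fun n hn => ?_⟩
  have h1 := (h n hn).1
  rw [hd] at h1
  have h2 := (G.fl (G.pos e n)).2.1
  rw [← h1] at h2
  have h3 : W e n ≤ W 0 n := G.anti n (Nat.zero_le e)
  simp at h2
  linarith

end Game

def sg (b : Bool) : ℤ := if b then 1 else -1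

def M0z (σ : List Bool) : ℤ := 1 + (σ.map sg).sum

def M0 (σ : List Bool) : ℝ := M0z σ

lemma M0_app (σ : List Bool) (c : Bool) : M0 (σ ++ [c]) = M0 σ + sg c := by
  simp [M0, M0z]; ring

def WW (S : ℕ → List Bool → ℝ) : ℕ → List Bool → ℝ
  | 0, σ => M0 σ
  | e+1, σ => ((⌊S e σ / WW S e σ⌋ : ℤ) + 1) * WW S e σ - S e σ

def qq (S : ℕ → List Bool → ℝ) (e : ℕ) (σ : List Bool) : ℤ := ⌊S e σ / WW S e σ⌋

open Classical in
def dir (S : ℕ → List Bool → ℝ) (D : ℕ → List Bool → ℤ) (σ : List Bool) : Bool :=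
  if h : ∃ e, D e σ ≠ qq S e σ then decide (D (Nat.find h) σ < qq S (Nat.find h) σ) else true

lemma dir_spec (S : ℕ → List Bool → ℝ) (D : ℕ → List Bool → ℤ) (σ : List Bool) (e : ℕ)
    (h1 : ∀ j < e, D j σ = qq S j σ) (h2 : D e σ ≠ qq S e σ) :
    dir S D σ = decide (D e σ < qq S e σ) := by
  classical
  have h : ∃ e, D e σ ≠ qq S e σ := ⟨e, h2⟩
  have he : Nat.find h = e := (Nat.find_eq_iff h).2 ⟨h2, fun j hj => by simpa using h1 j hj⟩
  unfold dir
  rw [dif_pos h]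
  have : ∀ k, k = e → decide (D k σ < qq S k σ) = decide (D e σ < qq S e σ) := by
    rintro k rfl; rfl
  exact this _ (by convert he)

def path (S : ℕ → List Bool → ℝ) (D : ℕ → List Bool → ℤ) : ℕ → List Bool
  | 0 => []
  | n+1 => path S D n ++ [dir S D (path S D n)]

lemma pre_succ (x : ℕ → Bool) (n : ℕ) : pre x (n+1) = pre x n ++ [x n] := by
  simp [pre, List.range_succ]

lemma pre_path (S : ℕ → List Bool → ℝ) (D : ℕ → List Bool → ℤ) (n : ℕ) :
    pre (fun n => dir S D (path S D n)) n = path S D n := by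
  induction n with
  | zero => simp [pre, path]
  | succ n ih => rw [pre_succ, ih, path]

lemma cover_app (M : List Bool → ℝ) (σ : List Bool) (c : Bool) :
    cover M (σ ++ [c]) = cover M σ + inc M σ * sg c := by
  unfold cover
  rw [List.length_append, List.length_singleton, Finset.sum_range_succ, ← add_assoc]
  congr 1
  · congr 1
    apply Finset.sum_congr rfl
    intro k hk
    have hk := Finset.mem_range.1 hk
    rw [List.getD_append _ _ _ _ hk, List.take_append_of_le_length hk.le]
  · cases c <;> simp [sg]

lemma inc_M0 (σ : List Bool) : inc M0 σ = 1 := by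
  unfold inc
  rw [M0_app, M0_app]
  simp [sg]

lemma sup_step (M : List Bool → ℝ) (h : IsSupermartingale M) (σ : List Bool) (c : Bool) :
    M (σ ++ [c]) ≤ M σ + inc M σ * sg c := by
  have := h σ
  unfold inc
  cases c <;> simp [sg] <;> linarith

/-- Adjoin the constants to the collection. -/
def extS (S : ℕ → List Bool → ℝ) (e : ℕ) (σ : List Bool) : ℝ :=
  if e % 2 = 0 then S (e/2) σ else (e : ℝ)

lemma ext_even (S : ℕ → List Bool → ℝ) (e : ℕ) : extS S (2*e) = S e := by
  funext σ; simp [extS]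

lemma ext_odd (S : ℕ → List Bool → ℝ) (e : ℕ) : extS S (2*e+1) = fun _ => ((2*e+1 : ℕ) : ℝ) := by
  funext σ
  have : (2*e+1) % 2 ≠ 0 := by omega
  simp [extS]

lemma main_game (S : ℕ → List Bool → ℝ) (D : ℕ → List Bool → ℤ)
    (h1 : ∀ e, IsSupermartingale (S e)) (h2 : ∀ e σ, 0 ≤ S e σ)
    (hD : ∀ e σ, inc (S e) σ = D e σ) :
    Game (fun e n => S e (path S D n)) (fun e n => WW S e (path S D n))
      (fun e n => D e (path S D n)) (fun e n => qq S e (path S D n))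
      (fun n => dir S D (path S D n)) (fun n => ((sg (dir S D (path S D n)) : ℤ) : ℝ))
      (fun n => M0z (path S D n)) where
  hξt n h := by simp [h, sg]
  hξf n h := by simp [h, sg]
  W00 := by simp [WW, path, M0, M0z]
  W0 n := by simp only [WW, path]; rw [M0_app]
  hz n := by simp [WW, M0]
  s0 e n := h2 _ _
  hs e n := by
    have := sup_step (S e) (h1 e) (path S D n) (dir S D (path S D n))
    rw [hD] at this
    exact this
  hd e n := by
    have := sup_step (S e) (h1 e) (path S D n) false
    rw [hD] at this
    have h3 := h2 e (path S D n ++ [false])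
    simp [sg] at this
    linarith
  hq e n := rfl
  hW e n := rfl
  rt e n h h' := by
    rw [dir_spec S D _ e h (by omega)]; simpa using h'
  rf e n h h' := by
    rw [dir_spec S D _ e h (by omega)]; simpa using h'.le
  ra n h := by
    have : ¬ ∃ e, D e (path S D n) ≠ qq S e (path S D n) := by
      push Not; exact h
    simp only [dir]
    rw [dif_neg this]

/-- ({1}, ∞-gains) anti-implies (ℤ, ∞-consumption): the always-bet-1 martingale with
initial capital 1 defeats any countable collection of nonnegative integer-wager
supermartingales with respect to ∞-consumption. -/
theorem stmt12 : ∃ M : List Bool → ℝ,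
    IsMartingale M ∧ M [] = 1 ∧ (∀ σ, inc M σ = 1) ∧
    ∀ S : ℕ → (List Bool → ℝ),
      (∀ e, IsSupermartingale (S e)) →
      (∀ e σ, 0 ≤ S e σ) →
      (∀ e σ, ∃ k : ℤ, inc (S e) σ = k) →
      ∃ x : ℕ → Bool, AchievesGains M x ∧ ∀ e, ¬ AchievesConsumption (S e) x := by
  refine ⟨M0, ?_, by simp [M0, M0z], inc_M0, ?_⟩
  · intro σ
    rw [M0_app, M0_app]
    simp [sg]; ring
  intro S h1 h2 h3
  have g1 : ∀ e, IsSupermartingale (extS S e) := by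
    intro e
    rcases Nat.even_or_odd' e with ⟨k, rfl | rfl⟩
    · rw [ext_even]; exact h1 k
    · rw [ext_odd]; intro σ; simp
  have g2 : ∀ e σ, 0 ≤ extS S e σ := by
    intro e σ
    rcases Nat.even_or_odd' e with ⟨k, rfl | rfl⟩
    · rw [ext_even]; exact h2 k σ
    · rw [ext_odd]; positivity
  have g3 : ∀ e σ, ∃ k : ℤ, inc (extS S e) σ = k := by
    intro e σ
    rcases Nat.even_or_odd' e with ⟨k, rfl | rfl⟩
    · rw [ext_even]; exact h3 k σ
    · rw [ext_odd]; exact ⟨0, by simp [inc]⟩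
  choose D hD using g3
  have G := main_game (extS S) D g1 g2 hD
  refine ⟨fun n => dir (extS S) D (path (extS S) D n), ⟨?_, ?_⟩, ?_⟩
  · rintro ⟨n, hn⟩
    rw [pre_path] at hn
    have h := G.one_le n
    simp only [WW] at h
    unfold Bankrupts marginal at hn
    rw [inc_M0, M0_app, M0_app] at hn
    simp [sg] at hn
    linarith
  · rw [tendsto_atTop]
    intro c
    obtain ⟨k, hk⟩ := exists_nat_gt c
    obtain ⟨N, hN⟩ := G.big (2*k+1) (fun n => by
      have := hD (2*k+1) (path (extS S) D n)
      rw [ext_odd] at this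
      simp [inc] at this
      exact_mod_cast this.symm)
    filter_upwards [eventually_ge_atTop N] with n hn
    have := hN n hn
    rw [pre_path]
    simp only [WW] at this
    rw [ext_odd] at this
    push_cast at this
    have hk0 : (0:ℝ) ≤ k := by positivity
    linarith
  · rintro e ⟨-, ht⟩
    obtain ⟨B, N, hB⟩ := G.bounded (2*e) (fun n => cover (S e) (path (extS S) D n)) (fun n => by
      simp only [path]
      rw [cover_app, ← hD, ext_even])
    have h5 := (ht.eventually_gt_atTop B).and (eventually_ge_atTop N)
    obtain ⟨n, hn, hn2⟩ := h5.exists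
    have := hB n hn2
    rw [pre_path] at hn
    simp only [ext_even] at this
    linarith
end
end

section
/- There exists a computable history-independent V-martingale, namely M with M(ε) = 2 and increment 1 + 1/n at step n, such that for any countable set of nonnegative integer-valued supermartingales {S_e} (assumed to include constant martingales of arbitrarily large capital), there is a binary sequence x on which M achieves ∞-gains (tends to infinity without bankruptcy), while every S_e(x↾n) converges to a finite limit. That is, (V, ∞-gains) anti-implies (ℤ, ∞-gains). -/
open Filter

noncomputable section

/-- One-step wager sign. -/
def sgn (c : Bool) : ℝ := if c then 1 else -1

/-- The martingale of the theorem. -/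
def MM (σ : List Bool) : ℝ :=
  2 + ∑ k ∈ Finset.range σ.length, sgn (σ.getD k false) * (1 + 1 / ((k : ℝ) + 1))

lemma MM_snoc (σ : List Bool) (c : Bool) :
    MM (σ ++ [c]) = MM σ + sgn c * (1 + 1 / ((σ.length : ℝ) + 1)) := by
  unfold MM
  rw [List.length_append, List.length_singleton, Finset.sum_range_succ, ← add_assoc]
  congr 1
  · congr 1
    apply Finset.sum_congr rfl
    intro k hk
    rw [List.getD_append _ _ _ _ (Finset.mem_range.1 hk)]
  · simp

lemma w_le (n : ℕ) : 1 / ((n : ℝ) + 1) ≤ 1 := by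
  rw [div_le_one (by positivity)]
  linarith [(Nat.cast_nonneg n : (0 : ℝ) ≤ n)]

lemma w_pos (n : ℕ) : 0 < 1 / ((n : ℝ) + 1) := by positivity

lemma MM_true (σ : List Bool) :
    MM (σ ++ [true]) = MM σ + (1 + 1 / ((σ.length : ℝ) + 1)) := by
  rw [MM_snoc]; simp [sgn]

lemma MM_false (σ : List Bool) :
    MM (σ ++ [false]) = MM σ - (1 + 1 / ((σ.length : ℝ) + 1)) := by
  rw [MM_snoc]; simp [sgn]; ring

lemma MM_nil : MM [] = 2 := by simp [MM]

lemma MM_le (σ : List Bool) : MM σ ≤ 2 + 2 * (σ.length : ℝ) := by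
  induction σ using List.reverseRecOn with
  | nil => simp [MM_nil]
  | append_singleton l c ih =>
    have h1 := w_le l.length
    have h2 := w_pos l.length
    rw [List.length_append, List.length_singleton]
    push_cast
    cases c
    · rw [MM_false]; linarith
    · rw [MM_true]; linarith

lemma MM_inc (σ : List Bool) : inc MM σ = 1 + 1 / ((σ.length : ℝ) + 1) := by
  unfold inc
  rw [MM_true, MM_false]; ring

lemma MM_mart : IsMartingale MM := by
  intro σ
  rw [MM_true, MM_false]; ring

/-- Safe reachability. -/
def Reach (B : ℝ) : List Bool → List Bool → Prop :=
  Relation.ReflTransGen (fun a b => B ≤ MM b ∧ ∃ c, b = a ++ [c])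

lemma run (B : ℝ) (Inv Goal : List Bool → Prop) (hsafe : ∀ ρ, Inv ρ → B ≤ MM ρ)
    (hstep : ∀ ρ, Inv ρ → ¬ Goal ρ → ∃ c, Inv (ρ ++ [c])) (N : ℕ)
    (hN : ∀ ρ, Inv ρ → N ≤ ρ.length → Goal ρ) :
    ∀ (d : ℕ) (σ : List Bool), N ≤ σ.length + d → Inv σ →
      ∃ τ, Reach B σ τ ∧ Inv τ ∧ Goal τ := by
  intro d
  induction d with
  | zero => intro σ h hi; exact ⟨σ, Relation.ReflTransGen.refl, hi, hN σ hi h⟩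
  | succ d ih =>
    intro σ h hi
    by_cases hg : Goal σ
    · exact ⟨σ, Relation.ReflTransGen.refl, hi, hg⟩
    · obtain ⟨c, hc⟩ := hstep σ hi hg
      obtain ⟨τ, h1, h2⟩ := ih (σ ++ [c]) (by simp; omega) hc
      exact ⟨τ, Relation.ReflTransGen.head ⟨hsafe _ hc, c, rfl⟩ h1, h2⟩

/-- What we use about an integer-wager supermartingale. -/
def Wag (T : List Bool → ℝ) : Prop :=
  ∀ ρ, ∃ k : ℤ, T (ρ ++ [true]) ≤ T ρ + k ∧ T (ρ ++ [false]) ≤ T ρ - k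

def HH (n : ℕ) : ℝ := ∑ k ∈ Finset.range n, 1 / ((k : ℝ) + 1)

lemma HH_succ (n : ℕ) : HH (n + 1) = HH n + 1 / ((n : ℝ) + 1) := by
  simp [HH, Finset.sum_range_succ]

lemma HH_large (C : ℝ) : ∃ N, ∀ n, N ≤ n → C ≤ HH n :=
  eventually_atTop.1 (Real.tendsto_sum_range_one_div_nat_succ_atTop.eventually_ge_atTop C)

/-- Basic move for ratio `R`. -/
lemma move (B : ℝ) (T : List Bool → ℝ) (hW : Wag T) (R : ℕ) (ρ : List Bool)
    (hn : 2 * R ≤ ρ.length + 1) : ∃ c,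
    R * (MM (ρ ++ [c]) - B) - T (ρ ++ [c]) ≥
      R * (MM ρ - B) - T ρ + R * (1 / ((ρ.length : ℝ) + 1)) ∧
    (MM ρ ≤ MM (ρ ++ [c]) ∨
      (R * (MM (ρ ++ [c]) - B) - T (ρ ++ [c]) ≥ R * (MM ρ - B) - T ρ + 1 / 2 ∧
       (R + 1) * (MM (ρ ++ [c]) - B) - T (ρ ++ [c]) ≥
        (R + 1) * (MM ρ - B) - T ρ - (R + 1) * (1 / ((ρ.length : ℝ) + 1)))) := by
  obtain ⟨k, h1, h2⟩ := hW ρ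
  have hw := w_pos ρ.length
  have hRw : (R : ℝ) * (1 / ((ρ.length : ℝ) + 1)) ≤ 1 / 2 := by
    have : (2 * R : ℝ) ≤ ρ.length + 1 := by exact_mod_cast hn
    rw [mul_one_div, div_le_iff₀ (by positivity)]
    linarith
  by_cases hk : k ≤ R
  · have hk' : (k : ℝ) ≤ R := by exact_mod_cast hk
    refine ⟨true, ?_, Or.inl ?_⟩
    · rw [MM_true]; linarith
    · rw [MM_true]; linarith
  · have hk' : (R : ℝ) + 1 ≤ k := by
      have : (R : ℤ) + 1 ≤ k := by omega
      exact_mod_cast this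
    refine ⟨false, ?_, Or.inr ⟨?_, ?_⟩⟩
    · rw [MM_false]; linarith
    · rw [MM_false]; linarith
    · rw [MM_false]; linarith

lemma move0 (B : ℝ) (T : List Bool → ℝ) (hW : Wag T) (R : ℝ) (ρ : List Bool) :
    ∃ c, R * (MM (ρ ++ [c]) - B) - T (ρ ++ [c]) ≥ R * (MM ρ - B) - T ρ := by
  obtain ⟨k, h1, h2⟩ := hW ρ
  rcases le_total (k : ℝ) (R * (1 + 1 / ((ρ.length : ℝ) + 1))) with h | h
  · refine ⟨true, ?_⟩
    rw [MM_true]; linarith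
  · refine ⟨false, ?_⟩
    rw [MM_false]; linarith

lemma safe_of (B : ℝ) (T : List Bool → ℝ) (hT : ∀ ρ, 0 ≤ T ρ) (R : ℝ) (hR : 0 < R)
    (ρ : List Bool) (h : 0 ≤ R * (MM ρ - B) - T ρ) : B ≤ MM ρ := by
  have h1 := hT ρ
  have : 0 ≤ R * (MM ρ - B) := by linarith
  have := nonneg_of_mul_nonneg_right this hR
  linarith

lemma phase1a (B : ℝ) (T : List Bool → ℝ) (hT : ∀ ρ, 0 ≤ T ρ) (hW : Wag T) (R : ℕ) (hR : 1 ≤ R)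
    (N : ℕ) (σ : List Bool) (h : 0 ≤ R * (MM σ - B) - T σ) :
    ∃ τ, Reach B σ τ ∧ 0 ≤ R * (MM τ - B) - T τ ∧ N ≤ τ.length := by
  have hR' : (0 : ℝ) < R := by exact_mod_cast hR
  refine run B (fun ρ => 0 ≤ R * (MM ρ - B) - T ρ) (fun ρ => N ≤ ρ.length)
    (fun ρ => safe_of B T hT R hR' ρ) ?_ N (fun _ _ h => h) N σ (by omega) h
  intro ρ hi _
  obtain ⟨c, hc⟩ := move0 B T hW R ρ
  exact ⟨c, by linarith⟩

lemma phase1b (B : ℝ) (T : List Bool → ℝ) (hT : ∀ ρ, 0 ≤ T ρ) (hW : Wag T) (R : ℕ) (hR : 1 ≤ R)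
    (C : ℝ) (σ : List Bool) (hn : 2 * R ≤ σ.length + 1) (h : 0 ≤ R * (MM σ - B) - T σ) :
    ∃ τ, Reach B σ τ ∧ (0 ≤ R * (MM τ - B) - T τ ∧ 2 * R ≤ τ.length + 1) ∧
      C ≤ R * (MM τ - B) - T τ := by
  have hR' : (1 : ℝ) ≤ R := by exact_mod_cast hR
  obtain ⟨N, hN⟩ := HH_large (|C| + HH σ.length)
  refine Exists.imp (fun τ hτ => ?_) (run B (fun ρ => (0 ≤ R * (MM ρ - B) - T ρ ∧ 2 * R ≤ ρ.length + 1) ∧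
      HH ρ.length - HH σ.length ≤ R * (MM ρ - B) - T ρ) (fun ρ => C ≤ R * (MM ρ - B) - T ρ)
    (fun ρ hi => safe_of B T hT R (by linarith) ρ hi.1.1) ?_ N ?_ N σ (by omega)
    ⟨⟨h, hn⟩, by simpa using h⟩)
  · exact ⟨hτ.1, hτ.2.1.1, hτ.2.2⟩
  · intro ρ hi _
    obtain ⟨c, hc, _⟩ := move B T hW R ρ hi.1.2
    have hw := w_pos ρ.length
    have h4 : 1 / ((ρ.length : ℝ) + 1) ≤ R * (1 / ((ρ.length : ℝ) + 1)) :=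
      le_mul_of_one_le_left hw.le hR'
    refine ⟨c, ⟨?_, ?_⟩, ?_⟩
    · linarith [hi.1.1]
    · have := hi.1.2; simp; omega
    · rw [List.length_append, List.length_singleton, HH_succ]
      linarith [hi.2]
  · intro ρ hi hl
    have := hN _ hl
    have := le_abs_self C
    linarith [hi.2]

lemma phase2 (B : ℝ) (hB : 0 ≤ B) (T : List Bool → ℝ) (hT : ∀ ρ, 0 ≤ T ρ) (hW : Wag T)
    (R : ℕ) (hR : 1 ≤ R) (σ : List Bool) (hn : 2 * R ≤ σ.length + 1)
    (h : 4 * ((R : ℝ) + 1) ^ 2 ≤ (R + 1) * (MM σ - B) - T σ) :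
    ∃ τ, Reach B σ τ ∧ 0 ≤ R * (MM τ - B) - T τ := by
  have hR' : (1 : ℝ) ≤ R := by exact_mod_cast hR
  set n0 : ℝ := (σ.length : ℝ) + 1 with hn0
  have hn0pos : 0 < n0 := by positivity
  have hm0 : B ≤ MM σ := safe_of B T hT (R + 1) (by linarith) σ (by nlinarith)
  obtain ⟨N, hN⟩ := HH_large (T σ + HH σ.length)
  set D0 : ℝ := (R + 1) * (MM σ - B) - T σ with hD0
  set E0 : ℝ := R * (MM σ - B) - T σ with hE0
  have hE0' : - T σ ≤ E0 := by
    have : 0 ≤ R * (MM σ - B) := mul_nonneg (by linarith) (by linarith)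
    linarith
  have hT0 : T σ ≤ (R + 1) * (2 * n0) := by
    have h1 := MM_le σ
    have h2 : (R + 1) * (MM σ - B) ≤ (R + 1) * (2 * n0) :=
      mul_le_mul_of_nonneg_left (by rw [hn0]; linarith) (by linarith)
    have : 0 ≤ 4 * ((R : ℝ) + 1) ^ 2 := by positivity
    linarith
  refine Exists.imp (fun τ hτ => ?_) (run B (fun ρ => B ≤ MM ρ ∧ σ.length ≤ ρ.length ∧
      E0 + (HH ρ.length - HH σ.length) ≤ R * (MM ρ - B) - T ρ ∧
      D0 * n0 + 2 * (R + 1) * E0 ≤ ((R + 1) * (MM ρ - B) - T ρ) * n0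
        + 2 * (R + 1) * (R * (MM ρ - B) - T ρ))
    (fun ρ => 0 ≤ R * (MM ρ - B) - T ρ)
    (fun ρ hi => hi.1) ?_ N ?_ N σ (by omega)
    ⟨hm0, le_rfl, by simp [hE0], le_rfl⟩)
  · exact ⟨hτ.1, hτ.2.2⟩
  · rintro ρ ⟨hi1, hi2, hi3, hi4⟩ hg
    obtain ⟨c, hc, hc2⟩ := move B T hW R ρ (by omega)
    have hw := w_pos ρ.length
    have h4 : 1 / ((ρ.length : ℝ) + 1) ≤ R * (1 / ((ρ.length : ℝ) + 1)) :=
      le_mul_of_one_le_left hw.le hR'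
    have hwn : 1 / ((ρ.length : ℝ) + 1) * n0 ≤ 1 := by
      rw [one_div, inv_mul_le_iff₀ (by positivity), hn0]
      have : (σ.length : ℝ) ≤ ρ.length := by exact_mod_cast hi2
      linarith
    have hpot : D0 * n0 + 2 * (R + 1) * E0 ≤
        ((R + 1) * (MM (ρ ++ [c]) - B) - T (ρ ++ [c])) * n0
        + 2 * (R + 1) * (R * (MM (ρ ++ [c]) - B) - T (ρ ++ [c])) := by
      refine hi4.trans ?_
      rcases hc2 with hc2 | ⟨hc2, hc3⟩
      · have e1 : R * (MM ρ - B) - T ρ ≤ R * (MM (ρ ++ [c]) - B) - T (ρ ++ [c]) := by linarith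
        have e2 : (R + 1) * (MM ρ - B) - T ρ ≤ (R + 1) * (MM (ρ ++ [c]) - B) - T (ρ ++ [c]) := by
          linarith
        gcongr
      · have e1 := mul_le_mul_of_nonneg_right hc3 hn0pos.le
        have e2 : 2 * ((R : ℝ) + 1) * (R * (MM ρ - B) - T ρ + 1 / 2) ≤
          2 * (R + 1) * (R * (MM (ρ ++ [c]) - B) - T (ρ ++ [c])) :=
          mul_le_mul_of_nonneg_left hc2 (by positivity)
        have e3 : ((R : ℝ) + 1) * (1 / ((ρ.length : ℝ) + 1) * n0) ≤ (R + 1) * 1 :=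
          mul_le_mul_of_nonneg_left hwn (by positivity)
        linarith
    refine ⟨c, ?_, ?_, ?_, hpot⟩
    · by_cases hd : 0 ≤ R * (MM (ρ ++ [c]) - B) - T (ρ ++ [c])
      · exact safe_of B T hT R (by linarith) _ hd
      · refine safe_of B T hT (R + 1) (by linarith) _ ?_
        push Not at hd
        have e1 : 2 * ((R : ℝ) + 1) * (R * (MM (ρ ++ [c]) - B) - T (ρ ++ [c])) ≤ 0 :=
          mul_nonpos_of_nonneg_of_nonpos (by positivity) hd.le
        have e2 : 4 * ((R : ℝ) + 1) ^ 2 * n0 ≤ D0 * n0 :=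
          mul_le_mul_of_nonneg_right h hn0pos.le
        have e3 : 2 * ((R : ℝ) + 1) * (- ((R + 1) * (2 * n0))) ≤ 2 * (R + 1) * E0 :=
          mul_le_mul_of_nonneg_left (by linarith) (by positivity)
        have : 0 ≤ ((R + 1) * (MM (ρ ++ [c]) - B) - T (ρ ++ [c])) * n0 := by nlinarith
        exact nonneg_of_mul_nonneg_left this hn0pos
    · simp; omega
    · rw [List.length_append, List.length_singleton, HH_succ]
      linarith
  · rintro ρ ⟨_, _, hi3, _⟩ hl
    have := hN _ hl
    linarith

lemma descend (B : ℝ) (hB : 0 ≤ B) (T : List Bool → ℝ) (hT : ∀ ρ, 0 ≤ T ρ) (hW : Wag T) (r : ℕ) :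
    ∀ σ, 0 ≤ ((r + 1 : ℕ) : ℝ) * (MM σ - B) - T σ → ∃ τ, Reach B σ τ ∧ T τ ≤ MM τ - B := by
  induction r with
  | zero => intro σ h; exact ⟨σ, Relation.ReflTransGen.refl, by simpa using h⟩
  | succ r ih =>
    intro σ h
    obtain ⟨τ1, p1, q1, l1⟩ := phase1a B T hT hW (r + 1 + 1) (by omega) (2 * (r + 1 + 1)) σ h
    obtain ⟨τ2, p2, q2, l2⟩ := phase1b B T hT hW (r + 1 + 1) (by omega)
      (4 * (((r + 1 : ℕ) : ℝ) + 1) ^ 2) τ1 (by omega) q1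
    obtain ⟨τ3, p3, q3⟩ := phase2 B hB T hT hW (r + 1) (by omega) τ2 (by omega)
      (by rw [Nat.cast_succ (r + 1)] at l2; exact l2)
    obtain ⟨τ4, p4, q4⟩ := ih τ3 q3
    exact ⟨τ4, ((p1.trans p2).trans p3).trans p4, q4⟩

lemma core (B : ℝ) (hB : 0 ≤ B) (T : List Bool → ℝ) (hT : ∀ ρ, 0 ≤ T ρ) (hW : Wag T)
    (σ : List Bool) (h : B ≤ MM σ) : ∃ τ, Reach B (σ ++ [true]) τ ∧ T τ ≤ MM τ - B := by
  obtain ⟨r, hr⟩ := exists_nat_ge (T (σ ++ [true]))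
  apply descend B hB T hT hW r
  have h1 : 1 ≤ MM (σ ++ [true]) - B := by
    rw [MM_true]; linarith [w_pos σ.length]
  have : ((r + 1 : ℕ) : ℝ) * 1 ≤ ((r + 1 : ℕ) : ℝ) * (MM (σ ++ [true]) - B) :=
    mul_le_mul_of_nonneg_left h1 (by positivity)
  push_cast at *
  linarith

/-- Control of the first `e` opponents. -/
def Ctl (S : ℕ → List Bool → ℝ) (σ : List Bool) (e : ℕ) : Prop :=
  2 * ∑ i ∈ Finset.range e, S i σ + 2 ≤ MM σ

lemma Ctl.mono {S : ℕ → List Bool → ℝ} (hS : ∀ e σ, 0 ≤ S e σ) {σ : List Bool} {e e' : ℕ}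
    (h : Ctl S σ e) (hle : e' ≤ e) : Ctl S σ e' := by
  unfold Ctl at *
  have := Finset.sum_le_sum_of_subset_of_nonneg (f := fun i => S i σ)
    (Finset.range_subset_range.2 hle) (fun i _ _ => hS i σ)
  linarith

/-- A segment. -/
def Seg (S : ℕ → List Bool → ℝ) (σ : List Bool) (e : ℕ) (τ : List Bool) (e' : ℕ) : Prop :=
  σ <+: τ ∧ Ctl S τ e' ∧
  (e' = e + 1 ∨ ∃ i < e, e' = i + 1 ∧ S i τ ≤ S i σ - 1) ∧
  ∀ ρ c, σ.length ≤ ρ.length → (ρ ++ [c]) <+: τ →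
    Ctl S ρ (min e e') ∧ ∀ i < min e e', S i (ρ ++ [c]) ≤ S i ρ

lemma seg_prepend {S : ℕ → List Bool → ℝ} (hS : ∀ e σ, 0 ≤ S e σ) {a : List Bool} {c : Bool}
    {e : ℕ} {τ : List Bool} {e' : ℕ} (ha : Ctl S a e) (hle : ∀ i < e, S i (a ++ [c]) ≤ S i a)
    (h : Seg S (a ++ [c]) e τ e') : Seg S a e τ e' := by
  obtain ⟨h1, h2, h3, h4⟩ := h
  refine ⟨(List.prefix_append a [c]).trans h1, h2, ?_, ?_⟩
  · rcases h3 with h3 | ⟨i, hi, h3, h5⟩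
    · exact Or.inl h3
    · exact Or.inr ⟨i, hi, h3, by linarith [hle i hi]⟩
  · intro ρ d hl hp
    by_cases hlt : (a ++ [c]).length ≤ ρ.length
    · exact h4 ρ d hlt hp
    · have : (ρ ++ [d]).length = (a ++ [c]).length := by simp at *; omega
      have heq := (List.prefix_of_prefix_length_le hp h1 this.le).eq_of_length this
      obtain ⟨rfl, hd⟩ := List.append_inj' heq rfl
      obtain rfl : d = c := by simpa using hd
      exact ⟨ha.mono hS (min_le_left _ _), fun i hi => hle i (lt_of_lt_of_le hi (min_le_left _ _))⟩

lemma one_step {S : ℕ → List Bool → ℝ} (hS : ∀ e σ, 0 ≤ S e σ) (hW : ∀ e, Wag (S e))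
    {a : List Bool} {e : ℕ} (ha : Ctl S a e) :
    (∀ c, ∀ i < e, S i (a ++ [c]) ≤ S i a) ∨
    ∃ c e', Seg S a e (a ++ [c]) e' := by
  classical
  by_cases hall : ∀ c, ∀ i < e, S i (a ++ [c]) ≤ S i a
  · exact Or.inl hall
  right
  have hex : ∃ i, i < e ∧ ∃ c, S i a < S i (a ++ [c]) := by
    push Not at hall
    obtain ⟨c, i, hi, h⟩ := hall
    exact ⟨i, hi, c, h⟩
  obtain ⟨hie, c0, hc0⟩ := Nat.find_spec hex
  have hmin : ∀ j < Nat.find hex, ∀ c, S j (a ++ [c]) ≤ S j a := by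
    intro j hj c
    by_contra hcon
    exact Nat.find_min hex hj ⟨hj.trans hie, c, not_le.1 hcon⟩
  set i := Nat.find hex
  obtain ⟨c, hc⟩ : ∃ c, S i (a ++ [c]) ≤ S i a - 1 := by
    obtain ⟨k, k1, k2⟩ := hW i a
    cases c0
    · have : (k : ℝ) < 0 := by linarith
      have : k ≤ -1 := by
        have : k < 0 := by exact_mod_cast this
        omega
      have : (k : ℝ) ≤ -1 := by exact_mod_cast this
      exact ⟨true, by linarith⟩
    · have : 0 < (k : ℝ) := by linarith
      have : 1 ≤ k := by
        have : 0 < k := by exact_mod_cast this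
        omega
      have : (1 : ℝ) ≤ k := by exact_mod_cast this
      exact ⟨false, by linarith⟩
  refine ⟨c, i + 1, List.prefix_append _ _, ?_, Or.inr ⟨i, hie, rfl, hc⟩, ?_⟩
  · have h1 : Ctl S a (i + 1) := ha.mono hS hie
    unfold Ctl at *
    rw [Finset.sum_range_succ] at *
    have h2 : ∑ j ∈ Finset.range i, S j (a ++ [c]) ≤ ∑ j ∈ Finset.range i, S j a :=
      Finset.sum_le_sum fun j hj => hmin j (Finset.mem_range.1 hj) c
    have h3 : MM a - 2 ≤ MM (a ++ [c]) := by
      have := w_le a.length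
      have := w_pos a.length
      cases c
      · rw [MM_false]; linarith
      · rw [MM_true]; linarith
    linarith
  · intro ρ d hl hp
    have : (ρ ++ [d]).length = (a ++ [c]).length := by
      have := hp.length_le
      simp at *; omega
    obtain ⟨rfl, hd⟩ := List.append_inj' (hp.eq_of_length this) rfl
    obtain rfl : d = c := by simpa using hd
    refine ⟨ha.mono hS (min_le_left _ _), fun j hj => ?_⟩
    rcases Nat.lt_succ_iff_lt_or_eq.1 (lt_of_lt_of_le hj (min_le_right _ _)) with h | h
    · exact hmin j h d
    · subst h; linarith

lemma follow {S : ℕ → List Bool → ℝ} (hS : ∀ e σ, 0 ≤ S e σ) (hW : ∀ e, Wag (S e))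
    {B : ℝ} {e : ℕ} {τ : List Bool} (hτ : 2 * S e τ ≤ MM τ - B) {a : List Bool}
    (hr : Reach B a τ) : B ≤ MM a → 2 * ∑ i ∈ Finset.range e, S i a + 2 ≤ B →
    ∃ τ' e', Seg S a e τ' e' := by
  induction hr using Relation.ReflTransGen.head_induction_on with
  | refl =>
    intro h1 h2
    refine ⟨τ, e + 1, List.prefix_rfl, ?_, Or.inl rfl, ?_⟩
    · unfold Ctl; rw [Finset.sum_range_succ]; linarith
    · intro ρ c hl hp
      have := hp.length_le
      simp at this; omega
  | head hab hbt ih =>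
    rename_i a b
    intro h1 h2
    obtain ⟨hb, c, rfl⟩ := hab
    have ha : Ctl S a e := by unfold Ctl; linarith
    rcases one_step hS hW ha with h | ⟨c, e', h⟩
    · have : ∑ i ∈ Finset.range e, S i (a ++ [c]) ≤ ∑ i ∈ Finset.range e, S i a :=
        Finset.sum_le_sum fun j hj => h c j (Finset.mem_range.1 hj)
      obtain ⟨τ', e', h'⟩ := ih hb (by linarith)
      exact ⟨τ', e', seg_prepend hS ha (h c) h'⟩
    · exact ⟨_, _, h⟩

lemma step {S : ℕ → List Bool → ℝ} (hS : ∀ e σ, 0 ≤ S e σ) (hW : ∀ e, Wag (S e))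
    (σ : List Bool) (e : ℕ) (ha : Ctl S σ e) :
    ∃ τ e', Seg S σ e τ e' ∧ σ.length < τ.length := by
  rcases one_step hS hW ha with h | ⟨c, e', h⟩
  · set B := 2 * ∑ i ∈ Finset.range e, S i σ + 2 with hBdef
    have hB : 0 ≤ B := by
      have := Finset.sum_nonneg (s := Finset.range e) (fun i _ => hS i σ)
      linarith
    obtain ⟨τ, h1, h2⟩ := core B hB (fun ρ => 2 * S e ρ) (fun ρ => by linarith [hS e ρ])
      (by
        intro ρ
        obtain ⟨k, k1, k2⟩ := hW e ρ
        refine ⟨2 * k, ?_, ?_⟩ <;> push_cast <;> linarith) σ ha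
    have : ∑ i ∈ Finset.range e, S i (σ ++ [true]) ≤ ∑ i ∈ Finset.range e, S i σ :=
      Finset.sum_le_sum fun j hj => h true j (Finset.mem_range.1 hj)
    obtain ⟨τ', e', h'⟩ := follow hS hW h2 h1
      (by rw [MM_true]; have := w_pos σ.length; unfold Ctl at ha; linarith) (by linarith)
    refine ⟨τ', e', seg_prepend hS ha (h true) h', ?_⟩
    have := h'.1.length_le
    simp at this; omega
  · exact ⟨_, _, h, by simp⟩

lemma no_inf_drop (f : ℕ → ℝ) (h0 : ∀ n, 0 ≤ f n) (J : ℕ) (hf : ∀ n ≥ J, f (n + 1) ≤ f n) :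
    ∃ K ≥ J, ∀ n ≥ K, ¬ f (n + 1) ≤ f n - 1 := by
  by_contra hcon
  push Not at hcon
  have hanti : ∀ d n, J ≤ n → f (n + d) ≤ f n := by
    intro d
    induction d with
    | zero => intro n _; simp
    | succ d ih => intro n hn; exact (hf (n + d) (by omega)).trans (ih n hn)
  have : ∀ m : ℕ, ∃ n ≥ J, f n ≤ f J - m := by
    intro m
    induction m with
    | zero => exact ⟨J, le_rfl, by simp⟩
    | succ m ih =>
      obtain ⟨n, hn, h⟩ := ih
      obtain ⟨k, hk, h'⟩ := hcon n hn
      obtain ⟨d, rfl⟩ := Nat.exists_eq_add_of_le hk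
      refine ⟨n + d + 1, by omega, ?_⟩
      have := hanti d n hn
      push_cast; linarith
  obtain ⟨m, hm⟩ := exists_nat_gt (f J)
  obtain ⟨n, _, h⟩ := this m
  linarith [h0 n]

lemma main (S : ℕ → List Bool → ℝ) (hS : ∀ e σ, 0 ≤ S e σ) (hW : ∀ e, Wag (S e)) :
    ∃ x : ℕ → Bool, (∀ n, 2 ≤ MM (pre x n)) ∧
      ∀ i, ∃ N, ∀ n ≥ N, S i (pre x (n + 1)) ≤ S i (pre x n) ∧ S i (pre x n) ≤ MM (pre x n) := by
  classical
  let St := {p : List Bool × ℕ // Ctl S p.1 p.2}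
  have hstep : ∀ p : St, ∃ q : St, Seg S p.1.1 p.1.2 q.1.1 q.1.2 ∧ p.1.1.length < q.1.1.length := by
    intro p
    obtain ⟨τ, e', h1, h2⟩ := step hS hW p.1.1 p.1.2 p.2
    exact ⟨⟨(τ, e'), h1.2.1⟩, h1, h2⟩
  choose nxt hseg hlen using hstep
  let s0 : St := ⟨([], 0), by simp [Ctl, MM_nil]⟩
  let g : ℕ → St := fun n => nxt^[n] s0
  have hg0 : g 0 = s0 := rfl
  have hgs : ∀ n, g (n + 1) = nxt (g n) := fun n => Function.iterate_succ_apply' nxt n s0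
  let L : ℕ → List Bool := fun n => (g n).1.1
  let E : ℕ → ℕ := fun n => (g n).1.2
  have hSeg : ∀ n, Seg S (L n) (E n) (L (n + 1)) (E (n + 1)) := by
    intro n
    have := hseg (g n)
    rw [← hgs] at this
    exact this
  have hLen : ∀ n, (L n).length < (L (n + 1)).length := by
    intro n
    have := hlen (g n)
    rw [← hgs] at this
    exact this
  have hmono : StrictMono fun n => (L n).length := strictMono_nat_of_lt_succ hLen
  have hpre : ∀ d n, L n <+: L (n + d) := by
    intro d
    induction d with
    | zero => intro n; exact List.prefix_rfl
    | succ d ih => intro n; exact (ih n).trans (hSeg (n + d)).1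
  have hpre' : ∀ m n, m ≤ n → L m <+: L n := by
    intro m n h
    obtain ⟨d, rfl⟩ := Nat.exists_eq_add_of_le h
    exact hpre d m
  have hge : ∀ n, n ≤ (L n).length := fun n => hmono.le_apply
  let x : ℕ → Bool := fun n => (L (n + 1)).getD n false
  have hx : ∀ j n, n < (L j).length → x n = (L j).getD n false := by
    intro j n hn
    have h1 : n < (L (n + 1)).length := hge (n + 1)
    simp only [x]
    rcases le_total j (n + 1) with h | h
    · obtain ⟨t, ht⟩ := hpre' _ _ h
      rw [← ht, List.getD_append _ _ _ _ hn]
    · obtain ⟨t, ht⟩ := hpre' _ _ h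
      rw [← ht, List.getD_append _ _ _ _ h1]
  have hpx : ∀ j n, n ≤ (L j).length → pre x n = (L j).take n := by
    intro j n hn
    apply List.ext_getElem
    · simp [pre, hn]
    · intro k h1 h2
      have hk : k < n := by simpa [pre] using h1
      simp only [pre, List.getElem_map, List.getElem_range, List.getElem_take]
      rw [hx j k (by omega), List.getD_eq_getElem]
  have hpsucc : ∀ n, pre x (n + 1) = pre x n ++ [x n] := by
    intro n; simp [pre, List.range_succ]
  have hplen : ∀ n, (pre x n).length = n := by intro n; simp [pre]
  have hfind : ∀ J n, (L J).length ≤ n → ∃ j ≥ J, (L j).length ≤ n ∧ n < (L (j + 1)).length := by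
    intro J n h
    have hex : ∃ k, n < (L k).length := ⟨n + 1, hge (n + 1)⟩
    have h1 := Nat.find_spec hex
    have h2 : J < Nat.find hex := by
      by_contra hcon
      have := hmono.monotone (not_lt.1 hcon)
      exact absurd h1 (not_lt.2 (le_trans this h))
    obtain ⟨j, hj⟩ : ∃ j, Nat.find hex = j + 1 := ⟨Nat.find hex - 1, by omega⟩
    refine ⟨j, by omega, not_lt.1 (Nat.find_min hex (by omega)), by rw [← hj]; exact h1⟩
  have hprop : ∀ J n, (L J).length ≤ n → ∃ j ≥ J, Ctl S (pre x n) (min (E j) (E (j + 1))) ∧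
      ∀ i < min (E j) (E (j + 1)), S i (pre x (n + 1)) ≤ S i (pre x n) := by
    intro J n h
    obtain ⟨j, hj, h1, h2⟩ := hfind J n h
    refine ⟨j, hj, ?_⟩
    have := (hSeg j).2.2.2 (pre x n) (x n) (by rw [hplen]; exact h1)
      (by rw [← hpsucc, hpx (j + 1) (n + 1) h2]; exact ⟨_, List.take_append_drop _ _⟩)
    rw [hpsucc]
    exact this
  -- the values along stages
  have hdecr : ∀ j i, i < min (E j) (E (j + 1)) → S i (L (j + 1)) ≤ S i (L j) := by
    intro j i hi
    have key : ∀ d, (L j).length + d ≤ (L (j + 1)).length →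
        S i ((L (j + 1)).take ((L j).length + d)) ≤ S i (L j) := by
      intro d
      induction d with
      | zero =>
        intro _
        rw [add_zero, ← List.prefix_iff_eq_take.1 (hSeg j).1]
      | succ d ih =>
        intro hd
        refine le_trans ?_ (ih (by omega))
        have e1 : (L (j + 1)).take ((L j).length + (d + 1)) =
            (L (j + 1)).take ((L j).length + d) ++ [x ((L j).length + d)] := by
          rw [← hpx (j + 1) _ hd, ← hpx (j + 1) _ (by omega), ← hpsucc]; rfl
        rw [e1]
        refine ((hSeg j).2.2.2 _ _ ?_ ?_).2 i hi
        · simp; omega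
        · rw [← e1]; exact ⟨_, List.take_append_drop _ _⟩
    have := key ((L (j + 1)).length - (L j).length) (by have := hLen j; omega)
    rwa [Nat.add_sub_cancel' (hLen j).le, List.take_length] at this
  have hE : ∀ i, ∃ J, ∀ j ≥ J, i ≤ E j := by
    intro i
    induction i with
    | zero => exact ⟨0, fun _ _ => Nat.zero_le _⟩
    | succ i ih =>
      obtain ⟨J, hJ⟩ := ih
      have hK : ∃ K ≥ J, ∀ j ≥ K, E (j + 1) ≠ i := by
        rcases i with _ | i
        · refine ⟨J, le_rfl, fun j _ h0 => ?_⟩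
          rcases (hSeg j).2.2.1 with h | ⟨k, _, h, _⟩ <;> omega
        · obtain ⟨K, hK, h⟩ := no_inf_drop (fun j => S i (L j)) (fun j => hS _ _) J
            (fun j hj => hdecr j i (lt_min (hJ j hj) (hJ (j + 1) (by omega))))
          refine ⟨K, hK, fun j hj h0 => ?_⟩
          rcases (hSeg j).2.2.1 with h' | ⟨k, _, h', h''⟩
          · have := hJ j (by omega)
            omega
          · obtain rfl : k = i := by omega
            exact h j hj h''
      obtain ⟨K, hKJ, hK⟩ := hK
      refine ⟨K + 1, fun j hj => ?_⟩
      obtain ⟨j, rfl⟩ : ∃ k, j = k + 1 := ⟨j - 1, by omega⟩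
      have h1 := hK j (by omega)
      have h2 := hJ (j + 1) (by omega)
      omega
  refine ⟨x, ?_, ?_⟩
  · intro n
    obtain ⟨j, _, h, _⟩ := hprop 0 n (by simp [L, hg0, s0])
    have := h.mono hS (Nat.zero_le _)
    simpa [Ctl] using this
  · intro i
    obtain ⟨J, hJ⟩ := hE (i + 1)
    refine ⟨(L J).length, fun n hn => ?_⟩
    obtain ⟨j, hj, h1, h2⟩ := hprop J n hn
    have hi : i + 1 ≤ min (E j) (E (j + 1)) := le_min (hJ j hj) (hJ (j + 1) (by omega))
    refine ⟨h2 i hi, ?_⟩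
    have h3 := h1.mono hS hi
    unfold Ctl at h3
    rw [Finset.sum_range_succ] at h3
    have := Finset.sum_nonneg (s := Finset.range i) (fun k _ => hS k (pre x n))
    linarith [hS i (pre x n)]

/-- (V, ∞-gains) anti-implies (ℤ, ∞-gains): the history-independent V-martingale with
initial capital 2 and wager 1 + 1/n at step n defeats any countable collection of
nonnegative integer-wager supermartingales (assumed to include constant martingales of
arbitrarily large capital): on some x it achieves ∞-gains while every member of the
collection converges to a finite limit. -/
theorem stmt14 : ∃ M : List Bool → ℝ,
    IsMartingale M ∧ HistoryIndependent M ∧ M [] = 2 ∧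
    (∀ σ : List Bool, inc M σ = 1 + 1 / ((σ.length : ℝ) + 1)) ∧
    ∀ S : ℕ → (List Bool → ℝ),
      (∀ e, IsSupermartingale (S e)) →
      (∀ e σ, 0 ≤ S e σ) →
      (∀ e σ, ∃ k : ℤ, inc (S e) σ = k) →
      (∀ c : ℕ, ∃ e, ∀ σ, S e σ = (c : ℝ)) →
      ∃ x : ℕ → Bool, AchievesGains M x ∧
        ∀ e, ∃ l : ℝ, Tendsto (fun n => S e (pre x n)) atTop (nhds l) := by
  refine ⟨MM, MM_mart, ?_, MM_nil, MM_inc, ?_⟩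
  · intro σ τ h
    rw [MM_inc, MM_inc, h]
  intro S hsup hS hint hconst
  have hW : ∀ e, Wag (S e) := by
    intro e ρ
    obtain ⟨k, hk⟩ := hint e ρ
    have h1 := hsup e ρ
    unfold inc at hk
    exact ⟨k, by linarith, by linarith⟩
  obtain ⟨x, h2, hx⟩ := main S hS hW
  refine ⟨x, ⟨?_, ?_⟩, ?_⟩
  · rintro ⟨n, hn⟩
    unfold Bankrupts marginal at hn
    rw [← MM_mart (pre x n), MM_inc] at hn
    have e1 := w_le (pre x n).length
    have e2 := w_pos (pre x n).length
    rw [abs_of_pos (by linarith)] at hn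
    linarith [h2 n]
  · rw [tendsto_atTop]
    intro C
    obtain ⟨c, hc⟩ := exists_nat_ge C
    obtain ⟨e, he⟩ := hconst c
    obtain ⟨N, hN⟩ := hx e
    filter_upwards [eventually_ge_atTop N] with n hn
    have := (hN n hn).2
    rw [he] at this
    linarith
  · intro e
    obtain ⟨N, hN⟩ := hx e
    have hanti : Antitone fun n => S e (pre x (n + N)) := by
      apply antitone_nat_of_succ_le
      intro n
      have := (hN (n + N) (by omega)).1
      rwa [show n + N + 1 = n + 1 + N by omega] at this
    refine ⟨_, (tendsto_add_atTop_iff_nat N).1 (tendsto_atTop_ciInf hanti ⟨0, ?_⟩)⟩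
    rintro _ ⟨n, rfl⟩
    exact hS _ _
end
end
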